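/- arXiv:1703.05655 — 2 statements merged into one kernel-verified Lean document; each statement's English description precedes it below -/
import Mathlib

section
/- Let T be the tree consisting of all functions f : β → 2 with β ≤ ω₁, together with, for each f : ω₁ → 2, the single extension f⌢⟨0⟩ of length ω₁ + 1, ordered by end-extension, and endowed with the coarse wedge topology. Then T is not a Valdivia compact space. -/
open Cardinal Ordinal Filter Set Topology

universe u v

section TreeDefs

variable {T : Type u} [PartialOrder T]

/-- `T` is a tree: the set of strict predecessors of every point is well-ordered by `<`. -/
def IsTreeOrder (T : Type u) [PartialOrder T] : Prop :=
  ∀ x : T, IsWellOrder {y : T // y < x} (· < ·)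

/-- Every chain has a supremum. -/
def ChainComplete (T : Type u) [PartialOrder T] : Prop :=
  ∀ c : Set T, IsChain (· ≤ ·) c → ∃ s, IsLUB c s

open Classical in
/-- The height `ht(x,T)` of `x`: the order type of the set of its strict predecessors. -/
noncomputable def htx (x : T) : Ordinal.{u} :=
  if h : IsWellOrder {y : T // y < x} (· < ·) then @Ordinal.type {y : T // y < x} (· < ·) h
  else 0

/-- The cofinality `cf(x)` of `ht(x,T)`. -/
noncomputable def cfx (x : T) : Cardinal.{u} := (htx x).cof

/-- `x` lies on a successor level. -/
def SuccLevel (x : T) : Prop := ∃ β : Ordinal, htx x = β + 1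

/-- The set of immediate successors of `x`. -/
def ims (x : T) : Set T := {y | x < y ∧ htx y = htx x + 1}

/-- The wedge `V_t = {s : t ≤ s}`. -/
def Vset (t : T) : Set T := {s | t ≤ s}

/-- Condition (*): every `t` with `cf(t) ≥ ω₁` has finitely many immediate successors. -/
def StarCond (T : Type u) [PartialOrder T] : Prop :=
  ∀ t : T, Cardinal.aleph 1 ≤ cfx t → (ims t).Finite

/-- The coarse wedge topology: generated by the sets `V_t` and their complements,
for `t` minimal or on a successor level. -/
def coarseWedge (T : Type u) [PartialOrder T] : TopologicalSpace T :=
  TopologicalSpace.generateFrom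
    {U : Set T | ∃ t : T, (IsMin t ∨ SuccLevel t) ∧ (U = Vset t ∨ U = (Vset t)ᶜ)}

open Classical in
/-- `s ∧ t = max (ŝ ∩ t̂)`, the largest common predecessor (when it exists). -/
noncomputable def wedge (s t : T) : T :=
  if h : ∃ m, IsGreatest {r : T | r ≤ s ∧ r ≤ t} m then h.choose else s

open Classical in
/-- `ψ(t) = ims(t)` if `cf(t) ≥ ω₁`, and `ψ(t) = {0}` (the root) otherwise. -/
noncomputable def psiSet (root : T) (t : T) : Set T :=
  if Cardinal.aleph 1 ≤ cfx t then ims t else {root}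

/-- `φ` is a choice function assigning to every `t` with `cf(t) = ω` a sequence of
successor-level elements strictly below `t` converging to `t`, and the constant
sequence at the root otherwise. -/
def PhiSpec [TopologicalSpace T] (root : T) (φ : T → ℕ → T) : Prop :=
  ∀ t : T,
    (cfx t ≠ Cardinal.aleph0 → ∀ n, φ t n = root) ∧
    (cfx t = Cardinal.aleph0 →
      (∀ n, φ t n < t ∧ SuccLevel (φ t n)) ∧ Tendsto (φ t) atTop (nhds t))

/-- Membership in the family `𝒜(T)`: countable subsets containing the root, closed
under `∧`, `φ` and `ψ`. -/
structure Admissible (root : T) (φ : T → ℕ → T) (A : Set T) : Prop where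
  countable : A.Countable
  root_mem : root ∈ A
  wedge_mem : ∀ s ∈ A, ∀ t ∈ A, wedge s t ∈ A
  phi_mem : ∀ t ∈ A, ∀ n, φ t n ∈ A
  psi_mem : ∀ t ∈ A, psiSet root t ⊆ A

/-- The height of the tree `T`: the least `α` such that the level `α` of `T` is empty. -/
noncomputable def treeHeight (T : Type u) [PartialOrder T] : Ordinal.{u} :=
  sInf {α : Ordinal | ∀ x : T, htx x ≠ α}

end TreeDefs

/-- A retractional skeleton on a compact space `K`: a family of continuous retractions
with metrizable compact ranges, indexed by an up-directed partially ordered set,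
commuting under the order, continuous under countable increasing suprema, and
converging pointwise to the identity. -/
structure RetractionalSkeleton (K : Type v) [TopologicalSpace K] where
  Γ : Type v
  [po : PartialOrder Γ]
  [ne : Nonempty Γ]
  directed : ∀ s t : Γ, ∃ u, s ≤ u ∧ t ≤ u
  r : Γ → K → K
  cont : ∀ s, Continuous (r s)
  retraction : ∀ s x, r s (r s x) = r s x
  compact_range : ∀ s, IsCompact (Set.range (r s))
  metrizable_range : ∀ s, TopologicalSpace.MetrizableSpace (Set.range (r s))
  comm : ∀ s t : Γ, s ≤ t → ∀ x, r s (r t x) = r s x ∧ r t (r s x) = r s x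
  seq_sup : ∀ s : ℕ → Γ, Monotone s → ∃ t : Γ, IsLUB (Set.range s) t ∧
      ∀ x, Tendsto (fun n => r (s n) x) atTop (nhds (r t x))
  net_conv : ∀ x : K, Tendsto (fun s : Γ => r s x) atTop (nhds x)

/-- The subset induced by a retractional skeleton: `D = ⋃ₛ rₛ[K]`. -/
def RetractionalSkeleton.inducedSet {K : Type v} [TopologicalSpace K]
    (R : RetractionalSkeleton K) : Set K :=
  ⋃ s : R.Γ, Set.range (R.r s)

/-- `A` is a `Σ`-subset of `K`: for some homeomorphic injection `h` of `K` into a cube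
`[0,1]^Γ`, `h(A) = h(K) ∩ Σ(Γ)`. -/
def IsSigmaSubset {K : Type v} [TopologicalSpace K] (A : Set K) : Prop :=
  ∃ (Γ : Type v) (h : K → Γ → Set.Icc (0 : ℝ) 1),
    Topology.IsEmbedding h ∧
      h '' A = Set.range h ∩ {x | {γ | (x γ : ℝ) ≠ 0}.Countable}

/-- `K` is a Valdivia compact space: it has a dense `Σ`-subset. -/
def IsValdivia (K : Type v) [TopologicalSpace K] : Prop :=
  ∃ A : Set K, Dense A ∧ IsSigmaSubset A

/-- The bounded topology on a product `∏_{α<ω₁} X_α`: basic open sets are the sets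
`V(g,β) = {f : f↾β = g↾β}` for `β < ω₁`. -/
def boundedTopology (X : Set.Iio (Cardinal.aleph 1).ord → Type v) :
    TopologicalSpace (∀ α, X α) :=
  TopologicalSpace.generateFrom
    {U | ∃ (g : ∀ α, X α) (β : Ordinal), β < (Cardinal.aleph 1).ord ∧
      U = {f | ∀ α : Set.Iio (Cardinal.aleph 1).ord, (α : Ordinal) < β → f α = g α}}

/-- The ordinal `ω₁`. -/
noncomputable def omega1 : Ordinal.{0} := (Cardinal.aleph 1).ord

/-- The tree of all functions `f : β → 2` with `β ≤ ω₁`, together with, for each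
`f : ω₁ → 2`, the single extension `f⌢⟨0⟩` of length `ω₁ + 1`.  An element is coded
as a pair `(β, f)` with `β ≤ ω₁ + 1` and `f : Iio β → Bool`, where the value at the
coordinate `ω₁` (if present) is `false`. -/
def TreeEx : Type 1 :=
  {p : (β : Ordinal.{0}) × (Set.Iio β → Bool) //
    p.1 ≤ omega1 + 1 ∧ ∀ h : omega1 < p.1, p.2 ⟨omega1, h⟩ = false}

/-- `TreeEx` is ordered by end-extension. -/
instance : PartialOrder TreeEx where
  le p q := p.1.1 ≤ q.1.1 ∧
    ∀ (α : Ordinal) (h1 : α < p.1.1) (h2 : α < q.1.1), p.1.2 ⟨α, h1⟩ = q.1.2 ⟨α, h2⟩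
  le_refl p := ⟨le_rfl, fun _ _ _ => rfl⟩
  le_trans p q r hpq hqr := ⟨hpq.1.trans hqr.1, fun α h1 h2 =>
    (hpq.2 α h1 (h1.trans_le hpq.1)).trans (hqr.2 α (h1.trans_le hpq.1) h2)⟩
  le_antisymm p q hpq hqp := by
    obtain ⟨⟨β, f⟩, hp⟩ := p
    obtain ⟨⟨γ, g⟩, hq⟩ := q
    have hβγ : β = γ := le_antisymm hpq.1 hqp.1
    subst hβγ
    have hfg : f = g := funext fun x => hpq.2 x.1 x.2 x.2
    subst hfg
    rfl

/-- `TreeEx` carries the coarse wedge topology. -/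
instance : TopologicalSpace TreeEx := coarseWedge TreeEx


namespace TreeEx

/-- The length of a node. -/
def len (x : TreeEx) : Ordinal.{0} := x.1.1

open Classical in
/-- The values of a node, extended by `false` beyond its length. -/
noncomputable def val (x : TreeEx) (α : Ordinal.{0}) : Bool :=
  if h : α < x.1.1 then x.1.2 ⟨α, h⟩ else false

theorem len_le (x : TreeEx) : x.len ≤ omega1 + 1 := x.2.1

theorem le_iff {x y : TreeEx} : x ≤ y ↔ x.len ≤ y.len ∧ ∀ α < x.len, x.val α = y.val α := by
  constructor
  · rintro ⟨h1, h2⟩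
    refine ⟨h1, fun α hα => ?_⟩
    have hα' : α < y.1.1 := lt_of_lt_of_le hα h1
    have hα'' : α < x.1.1 := hα
    simp only [val, hα', hα'', dif_pos]
    exact h2 α _ _
  · rintro ⟨h1, h2⟩
    refine ⟨h1, fun α hα hα' => ?_⟩
    have := h2 α hα
    simpa only [val, hα, hα', dif_pos] using this

theorem val_omega1 (x : TreeEx) : x.val omega1 = false := by
  unfold val
  split_ifs with h
  · exact x.2.2 h
  · rfl

open Classical in
/-- The restriction of `F` to `β`, with the value at `ω₁` replaced by `false`. -/
noncomputable def node (F : Ordinal.{0} → Bool) (β : Ordinal.{0}) (hβ : β ≤ omega1 + 1) : TreeEx :=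
  ⟨⟨β, fun α => if α.1 = omega1 then false else F α⟩, hβ, fun _ => if_pos rfl⟩

@[simp] theorem len_node (F : Ordinal.{0} → Bool) (β : Ordinal.{0}) (hβ : β ≤ omega1 + 1) :
    (node F β hβ).len = β := rfl

theorem val_node {F : Ordinal.{0} → Bool} {β : Ordinal.{0}} {hβ : β ≤ omega1 + 1}
    {α : Ordinal.{0}} (hα : α < β) (hα' : α < omega1) : (node F β hβ).val α = F α := by
  have : α < (node F β hβ).1.1 := hα
  simp only [val, this, dif_pos]
  exact if_neg hα'.ne

theorem val_congr_of_le {x y : TreeEx} (h : x ≤ y) {α : Ordinal.{0}} (hα : α < x.len) :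
    x.val α = y.val α := (le_iff.1 h).2 α hα

theorem node_le_iff {F : Ordinal.{0} → Bool} {β : Ordinal.{0}} {hβ : β ≤ omega1 + 1}
    {x : TreeEx} :
    node F β hβ ≤ x ↔ β ≤ x.len ∧ ∀ α < β, α < omega1 → F α = x.val α := by
  rw [le_iff, len_node]
  refine and_congr_right fun _ => forall₂_congr fun α hα => ?_
  constructor
  · intro h hα'
    rw [← h, val_node hα hα']
  · intro h
    rcases lt_trichotomy α omega1 with h1 | h1 | h1
    · rw [val_node hα h1, h h1]
    · rw [h1, val_omega1, val_omega1]
    · exact absurd (hα.trans_le hβ) (not_lt.2 (Order.add_one_le_of_lt h1))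

/-- The strict predecessors of a node of length `β` are ordered like `β`. -/
noncomputable def predIso (x : TreeEx) :
    ((· < ·) : {y : TreeEx // y < x} → {y : TreeEx // y < x} → Prop) ≃r
      ((· < ·) : Iio x.len → Iio x.len → Prop) := by
  have key : ∀ y z : TreeEx, y ≤ x → z ≤ x → (y ≤ z ↔ y.len ≤ z.len) := by
    intro y z hy hz
    refine ⟨fun h => (le_iff.1 h).1, fun h => le_iff.2 ⟨h, fun α hα => ?_⟩⟩
    rw [val_congr_of_le hy hα, val_congr_of_le hz (hα.trans_le h)]
  have keylt : ∀ y z : TreeEx, y ≤ x → z ≤ x → (y < z ↔ y.len < z.len) := by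
    intro y z hy hz
    rw [lt_iff_le_not_ge, lt_iff_le_not_ge, key y z hy hz, key z y hz hy]
  refine ⟨Equiv.ofBijective (fun y => ⟨y.1.len, (keylt _ _ y.2.le le_rfl).1 y.2⟩) ⟨?_, ?_⟩, ?_⟩
  · rintro ⟨y, hy⟩ ⟨z, hz⟩ h
    have h' : y.len = z.len := congrArg Subtype.val h
    exact Subtype.ext (le_antisymm ((key _ _ hy.le hz.le).2 h'.le)
      ((key _ _ hz.le hy.le).2 h'.ge))
  · rintro ⟨β, hβ⟩
    have hβ' : β < x.len := hβ
    have hle : node x.val β (hβ'.le.trans x.len_le) ≤ x := node_le_iff.2 ⟨hβ'.le, fun _ _ _ => rfl⟩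
    exact ⟨⟨_, (keylt _ _ hle le_rfl).2 hβ'⟩, rfl⟩
  · rintro ⟨y, hy⟩ ⟨z, hz⟩
    exact (keylt _ _ hy.le hz.le).symm

theorem htx_eq (x : TreeEx) : htx x = Ordinal.lift.{1} x.len := by
  have h : IsWellOrder {y : TreeEx // y < x} (· < ·) := x.predIso.toRelEmbedding.isWellOrder
  rw [htx, dif_pos h, ← Ordinal.type_lt_Iio]
  exact Ordinal.type_eq.2 ⟨x.predIso⟩

theorem isSuccLimit_omega1 : Order.IsSuccLimit omega1 := by
  unfold omega1
  rw [Cardinal.ord_aleph]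
  exact Cardinal.isSuccLimit_omega 1

theorem succLevel_of_len {x : TreeEx} {β : Ordinal.{0}} (h : x.len = β + 1) : SuccLevel x :=
  ⟨Ordinal.lift β, by rw [htx_eq, h]; simp⟩

theorem len_ne_omega1 {x : TreeEx} (h : IsMin x ∨ SuccLevel x) : x.len ≠ omega1 := by
  intro hx
  rcases h with h | ⟨β, hβ⟩
  · have hle : node x.val 0 (zero_le) ≤ x :=
      node_le_iff.2 ⟨zero_le, fun _ _ _ => rfl⟩
    have := (le_iff.1 (h hle)).1
    rw [hx, len_node] at this
    exact isSuccLimit_omega1.bot_lt.not_ge this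
  · rw [htx_eq, hx] at hβ
    have := Ordinal.isSuccLimit_lift.{1}.2 isSuccLimit_omega1
    rw [hβ] at this
    exact Order.not_isSuccLimit_succ β this

theorem omega1_pos : 0 < omega1 := isSuccLimit_omega1.bot_lt

theorem add_one_lt_omega1 {β : Ordinal.{0}} (h : β < omega1) : β + 1 < omega1 :=
  isSuccLimit_omega1.succ_lt h

theorem exists_bound_of_countable {S : Set Ordinal.{0}} (hS : S.Countable)
    (h : ∀ α ∈ S, α < omega1) : ∃ β < omega1, ∀ α ∈ S, α ≤ β := by
  rcases S.eq_empty_or_nonempty with rfl | hne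
  · exact ⟨0, omega1_pos, by simp⟩
  obtain ⟨f, rfl⟩ := hS.exists_eq_range hne
  refine ⟨⨆ n, f n, ?_, ?_⟩
  · have h' : ∀ n, f n < Ordinal.omega 1 := by
      intro n
      rw [← Cardinal.ord_aleph]
      exact h _ ⟨n, rfl⟩
    unfold omega1
    rw [Cardinal.ord_aleph]
    exact Ordinal.iSup_lt_omega_one h'
  · rintro _ ⟨n, rfl⟩
    exact Ordinal.le_iSup f n

/-- The point `F⌢⟨0⟩` for the branch `F ↾ ω₁`. -/
noncomputable def top (F : Ordinal.{0} → Bool) : TreeEx := node F (omega1 + 1) le_rfl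

/-- The point `F ↾ ω₁`. -/
noncomputable def branch (F : Ordinal.{0} → Bool) : TreeEx := node F omega1 le_self_add

theorem isOpen_singleton_top (F : Ordinal.{0} → Bool) : IsOpen {top F} := by
  have h : ({top F} : Set TreeEx) = Vset (top F) := by
    ext x
    refine ⟨fun hx => (mem_singleton_iff.1 hx).ge, fun hx => ?_⟩
    have hx' : top F ≤ x := hx
    refine le_antisymm (le_iff.2 ⟨x.len_le, fun α hα => ?_⟩) hx'
    exact (val_congr_of_le hx' (hα.trans_le x.len_le)).symm
  rw [h]
  exact TopologicalSpace.isOpen_generateFrom_of_mem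
    ⟨top F, Or.inr (succLevel_of_len (β := omega1) rfl), Or.inl rfl⟩

/-- `x` extends `F ↾ α`. -/
def Extends (x : TreeEx) (F : Ordinal.{0} → Bool) (α : Ordinal.{0}) : Prop :=
  α ≤ x.len ∧ ∀ δ < α, x.val δ = F δ

theorem Extends.mono {x : TreeEx} {F : Ordinal.{0} → Bool} {α β : Ordinal.{0}}
    (h : x.Extends F β) (hαβ : α ≤ β) : x.Extends F α :=
  ⟨hαβ.trans h.1, fun δ hδ => h.2 δ (hδ.trans_le hαβ)⟩

theorem Extends.congr {x : TreeEx} {F G : Ordinal.{0} → Bool} {β : Ordinal.{0}}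
    (h : x.Extends F β) (hFG : ∀ δ < β, F δ = G δ) : x.Extends G β :=
  ⟨h.1, fun δ hδ => (h.2 δ hδ).trans (hFG δ hδ)⟩

theorem extends_node (F : Ordinal.{0} → Bool) {α β : Ordinal.{0}} (hβ : β ≤ omega1 + 1)
    (hα : α ≤ β) (hα' : α ≤ omega1) : (node F β hβ).Extends F α :=
  ⟨hα, fun _ hδ => val_node (hδ.trans_le hα) (hδ.trans_le hα')⟩

/-- The trace of the neighbourhoods of a branch of length `ω₁`: sets which contain all extensions
of some `F ↾ α` with `α < ω₁`, except possibly `F⌢⟨0⟩`. -/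
def branchFilter (F : Ordinal.{0} → Bool) : Filter TreeEx :=
  Filter.ofCountableInter
    {s | ∃ α < omega1, ∀ x : TreeEx, x.Extends F α → x ≠ top F → x ∈ s}
    (by
      intro S hS h
      choose! a ha hx using h
      obtain ⟨β, hβ, hle⟩ := exists_bound_of_countable (hS.image a)
        (by rintro _ ⟨s, hs, rfl⟩; exact ha hs)
      exact ⟨β, hβ, fun x hxβ hxt s hs =>
        hx hs x (hxβ.mono (hle _ ⟨s, hs, rfl⟩)) hxt⟩)
    (by
      rintro s t ⟨α, hα, h⟩ hst
      exact ⟨α, hα, fun x hx hxt => hst (h x hx hxt)⟩)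

instance (F : Ordinal.{0} → Bool) : CountableInterFilter (branchFilter F) :=
  Filter.countableInter_ofCountableInter ..

theorem mem_branchFilter {F : Ordinal.{0} → Bool} {s : Set TreeEx} :
    s ∈ branchFilter F ↔ ∃ α < omega1, ∀ x : TreeEx, x.Extends F α → x ≠ top F → x ∈ s :=
  Iff.rfl

theorem branchFilter_le_nhds (F : Ordinal.{0} → Bool) : branchFilter F ≤ 𝓝 (branch F) := by
  have hnhds : 𝓝 (branch F) = _ := TopologicalSpace.nhds_generateFrom
  rw [hnhds]
  refine le_iInf₂ fun s hs => le_principal_iff.2 (mem_branchFilter.2 ?_)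
  obtain ⟨hFs, t, ht, rfl | rfl⟩ := hs
  · have htF : t ≤ branch F := hFs
    have hlt : t.len < omega1 := lt_of_le_of_ne (le_iff.1 htF).1 (len_ne_omega1 ht)
    refine ⟨t.len, hlt, fun x hx _ => le_iff.2 ⟨hx.1, fun α hα => ?_⟩⟩
    rw [hx.2 α hα, val_congr_of_le htF hα, branch, val_node (hα.trans hlt) (hα.trans hlt)]
  · by_cases hdiff : ∃ β < t.len, β < omega1 ∧ t.val β ≠ F β
    · obtain ⟨β, hβt, hβ, hne⟩ := hdiff
      refine ⟨β + 1, add_one_lt_omega1 hβ, fun x hx _ hxt => hne ?_⟩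
      rw [val_congr_of_le hxt hβt, hx.2 β (Order.lt_add_one_iff.2 le_rfl)]
    · push Not at hdiff
      have hlen : omega1 < t.len := by
        by_contra! hle
        refine hFs (le_iff.2 ⟨hle, fun α hα => ?_⟩)
        rw [hdiff α hα (hα.trans_le hle), branch, val_node (hα.trans_le hle) (hα.trans_le hle)]
      have hle : top F ≤ t := node_le_iff.2 ⟨Order.add_one_le_of_lt hlen, fun α _ hα' =>
        (hdiff α (hα'.trans hlen) hα').symm⟩
      refine ⟨0, omega1_pos, fun x _ hxt hx => hxt (le_antisymm ?_ (hle.trans hx))⟩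
      have hxF : top F ≤ x := hle.trans hx
      exact le_iff.2 ⟨x.len_le, fun α hα => (val_congr_of_le hxF (hα.trans_le x.len_le)).symm⟩

section Coordinates

variable {Γ : Type*} {h : TreeEx → Γ → ℝ}

/-- The coordinates which vanish nowhere on the wedge of `F ↾ β`. -/
def nonvanishing (h : TreeEx → Γ → ℝ) (F : Ordinal.{0} → Bool) (β : Ordinal.{0}) : Set Γ :=
  {γ | ∀ x : TreeEx, x.Extends F β → h x γ ≠ 0}

theorem nonvanishing_mono {F G : Ordinal.{0} → Bool} {α β : Ordinal.{0}} (hαβ : α ≤ β)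
    (hFG : ∀ δ < α, F δ = G δ) : nonvanishing h F α ⊆ nonvanishing h G β :=
  fun _ hγ x hx => hγ x ((hx.mono hαβ).congr fun δ hδ => (hFG δ hδ).symm)

theorem nonvanishing_subset_support_top (F : Ordinal.{0} → Bool) {β : Ordinal.{0}}
    (hβ : β < omega1) : nonvanishing h F β ⊆ {γ | h (top F) γ ≠ 0} :=
  fun _ hγ => hγ _ (extends_node F le_rfl (hβ.le.trans le_self_add) hβ.le)

theorem exists_nonvanishing_extension (hc : Continuous h) (hinj : Function.Injective h)
    (hs : ∀ F, {γ | h (top F) γ ≠ 0}.Countable) (F : Ordinal.{0} → Bool) {β : Ordinal.{0}}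
    (hβ : β < omega1) :
    ∃ (G : Ordinal.{0} → Bool) (δ : Ordinal.{0}), δ < omega1 ∧ β < δ ∧ (∀ α < β, F α = G α) ∧
      ∃ γ ∈ nonvanishing h G δ, γ ∉ nonvanishing h F β := by
  by_contra! hcon
  have hcγ : ∀ γ, Continuous fun x => h x γ := fun γ => (continuous_apply γ).comp hc
  have hzero : ∀ G : Ordinal.{0} → Bool, (∀ α < β, F α = G α) → ∀ γ ∉ nonvanishing h F β,
      h (branch G) γ = 0 := by
    intro G hFG γ hγ
    by_contra hne
    obtain ⟨α, hα, hx⟩ := mem_branchFilter.1 <| branchFilter_le_nhds G <|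
      (hcγ γ).continuousAt.eventually_ne hne
    have hm : max α β < omega1 := max_lt hα hβ
    have hupd : ∀ δ < max α β, Function.update G (max α β) (!G (max α β)) δ = G δ :=
      fun δ hδ => Function.update_of_ne hδ.ne _ _
    refine hγ (hcon (Function.update G (max α β) (!G (max α β))) (max α β + 1)
      (add_one_lt_omega1 hm) (Order.lt_add_one_iff.2 (le_max_right _ _))
      (fun δ hδ => (hFG δ hδ).trans (hupd δ (hδ.trans_le (le_max_right _ _))).symm) γ ?_)
    intro x hxG
    refine hx x ((hxG.mono ((le_max_left α β).trans le_self_add)).congr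
      fun δ hδ => hupd δ (hδ.trans_le (le_max_left _ _))) ?_
    rintro rfl
    have h1 := hxG.2 (max α β) (Order.lt_add_one_iff.2 le_rfl)
    rw [top, val_node (hm.trans_le le_self_add) hm, Function.update_self] at h1
    simp at h1
  have hN : (nonvanishing h F β).Countable :=
    (hs F).mono (nonvanishing_subset_support_top F hβ)
  have hconst : ∀ γ ∈ nonvanishing h F β,
      {x | h x γ = h (branch F) γ} ∈ branchFilter F := by
    intro γ _
    have hn : ∀ n : ℕ, {x | dist (h x γ) (h (branch F) γ) < 1 / (n + 1 : ℝ)} ∈ branchFilter F :=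
      fun n => branchFilter_le_nhds F <|
        (hcγ γ).continuousAt.eventually (Metric.ball_mem_nhds _ Nat.one_div_pos_of_nat)
    refine mem_of_superset (countable_iInter_mem.2 hn) fun x hx => ?_
    by_contra hne
    obtain ⟨n, hn'⟩ := exists_nat_one_div_lt (dist_pos.2 hne)
    exact lt_asymm hn' (mem_iInter.1 hx n)
  obtain ⟨α, hα, hx⟩ := mem_branchFilter.1 ((countable_bInter_mem hN).2 hconst)
  have hm : max α β < omega1 := max_lt hα hβ
  set G := Function.update F (max α β) (!F (max α β)) with hG
  have hupd : ∀ δ < max α β, G δ = F δ := fun δ hδ => Function.update_of_ne hδ.ne _ _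
  have hne : branch G ≠ branch F := by
    intro heq
    have h1 := congrArg (fun x => x.val (max α β)) heq
    simp only [branch, val_node hm hm, hG, Function.update_self] at h1
    simp at h1
  have hGtop : branch G ≠ top F := by
    intro heq
    have h1 : omega1 = omega1 + 1 := congrArg len heq
    exact (Order.lt_add_one_iff.2 (le_refl omega1)).ne h1
  refine hne (hinj (funext fun γ => ?_))
  by_cases hγ : γ ∈ nonvanishing h F β
  · exact mem_iInter₂.1 (hx (branch G) ((extends_node G _ hα.le hα.le).congr
      fun δ hδ => hupd δ (hδ.trans_le (le_max_left _ _))) hGtop) γ hγ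
  · rw [hzero F (fun _ _ => rfl) γ hγ,
      hzero G (fun δ hδ => (hupd δ (hδ.trans_le (le_max_right _ _))).symm) γ hγ]

/-- A continuous injection into a cube maps some point `F⌢⟨0⟩` outside the `Σ`-product. -/
theorem exists_not_countable_support_top (hc : Continuous h) (hinj : Function.Injective h) :
    ∃ F, ¬ {γ | h (top F) γ ≠ 0}.Countable := by
  by_contra! hs
  let r : (Ordinal.{0} → Bool) × Iio omega1 → (Ordinal.{0} → Bool) × Iio omega1 → Prop :=
    fun p q => p.2 < q.2 ∧ (∀ α < p.2.1, p.1 α = q.1 α) ∧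
      ∃ γ ∈ nonvanishing h q.1 q.2, γ ∉ nonvanishing h p.1 p.2
  have hext : ∀ F, ∀ β : Iio omega1, ∃ q, r (F, β) q := by
    intro F β
    obtain ⟨G, δ, hδ, hβδ, hFG, hγ⟩ := exists_nonvanishing_extension hc hinj hs F β.2
    exact ⟨(G, ⟨δ, hδ⟩), hβδ, hFG, hγ⟩
  have htrans : ∀ {a b c}, r a b → r b c → r a c := by
    rintro a b c ⟨hab, hab', -⟩ ⟨hbc, hbc', γ, hγ, hγ'⟩
    refine ⟨hab.trans hbc, fun α hα => (hab' α hα).trans (hbc' α (hα.trans hab)), γ, hγ,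
      fun hγa => hγ' (nonvanishing_mono hab.le hab' hγa)⟩
  suffices hbound : ∀ C, IsChain r C → ∃ ub, ∀ a ∈ C, r a ub by
    obtain ⟨m, hm⟩ := exists_maximal_of_chains_bounded hbound htrans
    obtain ⟨q, hq⟩ := hext m.1 m.2
    exact lt_asymm hq.1 (hm q hq).1
  intro C hC
  have hlt : ∀ p ∈ C, ∀ q ∈ C, p.2 < q.2 → r p q := by
    intro p hp q hq hpq
    rcases hC hp hq (fun heq => hpq.ne (congrArg Prod.snd heq)) with h1 | h1
    · exact h1
    · exact absurd h1.1 hpq.not_gt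
  have hagree : ∀ p ∈ C, ∀ q ∈ C, ∀ α < p.2.1, α < q.2.1 → p.1 α = q.1 α := by
    intro p hp q hq α hαp hαq
    by_cases heq : p = q
    · rw [heq]
    rcases hC hp hq heq with h1 | h1
    · exact h1.2.1 α hαp
    · exact (h1.2.1 α hαq).symm
  obtain ⟨F, hF⟩ : ∃ F : Ordinal.{0} → Bool, ∀ p ∈ C, ∀ α < p.2.1, p.1 α = F α := by
    classical
    refine ⟨fun α => if hα : ∃ p ∈ C, α < p.2.1 then hα.choose.1 α else false,
      fun p hp α hα => ?_⟩
    have hex : ∃ p ∈ C, α < p.2.1 := ⟨p, hp, hα⟩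
    simp only [hex, dif_pos]
    exact hagree p hp _ hex.choose_spec.1 α hα hex.choose_spec.2
  by_cases hbdd : ∃ β : Iio omega1, ∀ p ∈ C, p.2 ≤ β
  · obtain ⟨β, hβ⟩ := hbdd
    obtain ⟨q, hq, hq', γ, hγ, hγ'⟩ := hext F β
    refine ⟨q, fun p hp => ⟨(hβ p hp).trans_lt hq, fun α hα =>
      (hF p hp α hα).trans (hq' α (hα.trans_le (hβ p hp))), γ, hγ, fun hγp => hγ' ?_⟩⟩
    exact nonvanishing_mono (hβ p hp) (hF p hp) hγp
  · push Not at hbdd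
    exfalso
    have hD : (⋃ p ∈ C, nonvanishing h p.1 p.2).Countable := by
      refine (hs F).mono (iUnion₂_subset fun p hp => ?_)
      exact (nonvanishing_mono le_rfl (hF p hp)).trans (nonvanishing_subset_support_top F p.2.2)
    have hsel : ∀ γ ∈ ⋃ p ∈ C, nonvanishing h p.1 p.2, ∃ p ∈ C, γ ∈ nonvanishing h p.1 p.2 :=
      fun γ hγ => by simpa only [mem_iUnion, exists_prop] using hγ
    have : Nonempty ((Ordinal.{0} → Bool) × Iio omega1) := ⟨(F, ⟨0, omega1_pos⟩)⟩
    choose! s hsC hsγ using hsel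
    obtain ⟨β, hβ, hle⟩ := exists_bound_of_countable (hD.image fun γ => (s γ).2.1)
      (by rintro _ ⟨γ, -, rfl⟩; exact (s γ).2.2)
    obtain ⟨p, hp, hβp⟩ := hbdd ⟨β, hβ⟩
    obtain ⟨q, hq, hpq⟩ := hbdd p.2
    obtain ⟨-, -, γ, hγq, hγp⟩ := hlt p hp q hq hpq
    have hγD : γ ∈ ⋃ p ∈ C, nonvanishing h p.1 p.2 := mem_iUnion₂.2 ⟨q, hq, hγq⟩
    have hlt' : (s γ).2 < p.2 := lt_of_le_of_lt (hle _ ⟨γ, hγD, rfl⟩) hβp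
    exact hγp (nonvanishing_mono hlt'.le (hlt _ (hsC γ hγD) p hp hlt').2.1 (hsγ γ hγD))

end Coordinates

end TreeEx

theorem stmt18 : ¬ IsValdivia TreeEx := by
  rintro ⟨A, hA, Γ, h, hemb, himg⟩
  have hc : Continuous fun x γ => (h x γ : ℝ) :=
    continuous_pi fun γ => continuous_subtype_val.comp ((continuous_apply γ).comp hemb.continuous)
  have hinj : Function.Injective fun x γ => (h x γ : ℝ) := fun x y hxy =>
    hemb.injective (funext fun γ => Subtype.ext (congrFun hxy γ))
  obtain ⟨F, hF⟩ := TreeEx.exists_not_countable_support_top hc hinj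
  obtain ⟨_, rfl, hxA⟩ := hA.inter_open_nonempty _ (TreeEx.isOpen_singleton_top F)
    (singleton_nonempty _)
  have hmem : h (TreeEx.top F) ∈ h '' A := mem_image_of_mem h hxA
  rw [himg] at hmem
  exact hF hmem.2
end

section
/- Let T be the tree consisting of all functions f : β → 2 with β ≤ ω₁, together with, for each f : ω₁ → 2, the single extension f⌢⟨0⟩ of length ω₁ + 1, ordered by end-extension, and endowed with the coarse wedge topology. Then the level Lev_{ω₁}(T) = {f : ω₁ → 2}, with the subspace topology inherited from T, is homeomorphic to 2^{ω₁} endowed with the bounded topology. -/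
open Cardinal Ordinal Filter Set Topology

universe u v

namespace TreeEx

/-- The length of an element of the tree, seen as a function. -/
def length (p : TreeEx) : Ordinal.{0} := p.1.1

/-- The restriction of `p` to `α`, for `α` at most the length of `p`. -/
def restrict (p : TreeEx) (α : Ordinal.{0}) (h : α ≤ p.length) : TreeEx :=
  ⟨⟨α, fun x => p.1.2 ⟨x.1, x.2.trans_le h⟩⟩, h.trans p.2.1,
    fun h' => p.2.2 (h'.trans_le h)⟩

theorem restrict_le (p : TreeEx) (α : Ordinal.{0}) (h : α ≤ p.length) : p.restrict α h ≤ p :=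
  ⟨h, fun _ _ _ => rfl⟩

theorem le_of_agree {p q : TreeEx} (hl : p.length ≤ q.length)
    (h : ∀ (α : Ordinal) (h1 : α < p.length) (h2 : α < q.length),
      p.1.2 ⟨α, h1⟩ = q.1.2 ⟨α, h2⟩) : p ≤ q :=
  ⟨hl, h⟩

theorem le_of_le_of_length_le {p q r : TreeEx} (hp : p ≤ r) (hq : q ≤ r)
    (h : p.length ≤ q.length) : p ≤ q :=
  ⟨h, fun α h1 h2 => (hp.2 α h1 (h1.trans_le hp.1)).trans (hq.2 α h2 (h2.trans_le hq.1)).symm⟩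

theorem length_lt_of_lt {p q : TreeEx} (h : p < q) : p.length < q.length :=
  lt_of_not_ge fun h' => h.not_ge (le_of_le_of_length_le le_rfl h.le h')

/-- The strict predecessors of `p` are classified by their lengths. -/
noncomputable def predecessorsIso (p : TreeEx) :
    ((· < ·) : {q : TreeEx // q < p} → {q : TreeEx // q < p} → Prop) ≃r
      ((· < ·) : Set.Iio p.length → Set.Iio p.length → Prop) where
  toFun q := ⟨q.1.length, length_lt_of_lt q.2⟩
  invFun α := ⟨p.restrict α.1 (le_of_lt α.2),
    lt_of_le_not_ge (restrict_le _ _ _) fun h => (not_le_of_gt α.2) h.1⟩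
  left_inv q :=
    have hle : p.restrict q.1.length (length_lt_of_lt q.2).le ≤ p := restrict_le _ _ _
    Subtype.ext <| le_antisymm (le_of_le_of_length_le hle q.2.le le_rfl)
      (le_of_le_of_length_le q.2.le hle le_rfl)
  right_inv _ := rfl
  map_rel_iff' {a b} := by
    change a.1.length < b.1.length ↔ a.1 < b.1
    exact ⟨fun h => lt_of_le_not_ge (le_of_le_of_length_le a.2.le b.2.le h.le)
      fun h' => h.not_ge h'.1, length_lt_of_lt⟩

theorem htx_eq_lift_length (p : TreeEx) : htx p = Ordinal.lift.{1} p.length := by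
  have hw : IsWellOrder {q : TreeEx // q < p} (· < ·) :=
    p.predecessorsIso.toRelEmbedding.isWellOrder
  rw [htx, dif_pos hw, ← Ordinal.type_lt_Iio]
  exact Ordinal.type_eq.2 ⟨p.predecessorsIso⟩

theorem lift_omega1 : Ordinal.lift.{1} omega1 = (Cardinal.aleph 1).ord := by
  simp [omega1]

theorem htx_eq_iff (p : TreeEx) : htx p = (Cardinal.aleph 1).ord ↔ p.length = omega1 := by
  rw [htx_eq_lift_length, ← lift_omega1, Ordinal.lift_inj]

/-- A function `ω₁ → 2`, as an element of the tree. -/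
noncomputable def ofFun (f : Set.Iio omega1 → Bool) : TreeEx :=
  ⟨⟨omega1, f⟩, le_self_add, fun h => (lt_irrefl _ h).elim⟩

theorem length_ne_omega1 {t : TreeEx} (ht : IsMin t ∨ SuccLevel t) : t.length ≠ omega1 := by
  have hlim : Order.IsSuccLimit (Cardinal.aleph 1).ord :=
    Cardinal.isSuccLimit_ord (Cardinal.aleph0_le_aleph 1)
  intro h
  rcases ht with ht | ⟨β, hβ⟩
  · have h0 : t.length ≤ 0 := (ht (restrict_le t 0 zero_le)).1
    rw [h] at h0
    exact isSuccLimit_omega1.bot_lt.not_ge h0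
  · rw [(htx_eq_iff t).2 h] at hβ
    rw [hβ] at hlim
    exact Order.not_isSuccLimit_succ β (by rwa [Order.succ_eq_add_one])

theorem succLevel_of_length {t : TreeEx} {β : Ordinal.{0}} (h : t.length = β + 1) :
    SuccLevel t :=
  ⟨Ordinal.lift.{1} β, by rw [htx_eq_lift_length, h]; simp⟩

/-- Members of level `ω₁` correspond to functions `ω₁ → 2`. -/
noncomputable def levelEquiv :
    {p : TreeEx // htx p = (Cardinal.aleph 1).ord} ≃ (Set.Iio omega1 → Bool) where
  toFun p α := p.1.1.2 ⟨α.1, lt_of_lt_of_eq α.2 ((htx_eq_iff _).1 p.2).symm⟩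
  invFun f := ⟨ofFun f, (htx_eq_iff _).2 rfl⟩
  left_inv p := Subtype.ext <| le_antisymm
    (le_of_agree ((htx_eq_iff _).1 p.2).ge fun _ _ _ => rfl)
    (le_of_agree ((htx_eq_iff _).1 p.2).le fun _ _ _ => rfl)
  right_inv _ := rfl

theorem continuous_levelEquiv :
    @Continuous _ _ _ (boundedTopology fun _ : Set.Iio omega1 => Bool) levelEquiv := by
  refine continuous_generateFrom_iff.2 ?_
  rintro _ ⟨g, β, hβ, rfl⟩
  have hβ' : β + 1 < omega1 := isSuccLimit_omega1.add_one_lt hβ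
  refine isOpen_iff_mem_nhds.2 fun p hp => ?_
  have hle : β + 1 ≤ p.1.length := hβ'.le.trans ((htx_eq_iff _).1 p.2).ge
  let t := p.1.restrict (β + 1) hle
  have hopen : IsOpen (Vset t) := TopologicalSpace.isOpen_generateFrom_of_mem
    ⟨t, Or.inr (succLevel_of_length rfl), Or.inl rfl⟩
  refine Filter.mem_of_superset
    ((hopen.preimage continuous_subtype_val).mem_nhds (restrict_le p.1 _ hle)) ?_
  intro q hq α hα
  have hα' : α.1 < β + 1 := hα.trans (lt_add_one β)
  exact (hq.2 α.1 hα' _).symm.trans (hp α hα)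

theorem isOpen_agree (g : Set.Iio omega1 → Bool) {β : Ordinal.{0}} (hβ : β < omega1) :
    IsOpen[boundedTopology fun _ : Set.Iio omega1 => Bool]
      {f | ∀ α : Set.Iio omega1, α.1 < β → f α = g α} :=
  TopologicalSpace.isOpen_generateFrom_of_mem ⟨g, β, hβ, rfl⟩

theorem isOpen_of_agree {s : Set (Set.Iio omega1 → Bool)} {β : Ordinal.{0}} (hβ : β < omega1)
    (hs : ∀ f ∈ s, ∀ g, (∀ α : Set.Iio omega1, α.1 < β → g α = f α) → g ∈ s) :
    IsOpen[boundedTopology fun _ : Set.Iio omega1 => Bool] s := by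
  let _ := boundedTopology fun _ : Set.Iio omega1 => Bool
  exact isOpen_iff_mem_nhds.2 fun f hf =>
    Filter.mem_of_superset ((isOpen_agree f hβ).mem_nhds fun _ _ => rfl) (hs f hf)

theorem ofFun_mem_Vset_of_agree {t : TreeEx} {f g : Set.Iio omega1 → Bool}
    (hfg : ∀ α : Set.Iio omega1, α.1 < t.length → g α = f α) (h : t ≤ ofFun f) :
    t ≤ ofFun g :=
  ⟨h.1, fun α h1 h2 => (h.2 α h1 h2).trans (hfg ⟨α, h2⟩ h1).symm⟩

theorem continuous_ofFun :
    @Continuous _ _ (boundedTopology fun _ : Set.Iio omega1 => Bool) _ ofFun := by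
  let _ := boundedTopology fun _ : Set.Iio omega1 => Bool
  refine continuous_generateFrom_iff.2 ?_
  rintro U ⟨t, ht, hU⟩
  rcases (length_ne_omega1 ht).lt_or_gt with hlt | hgt
  · rcases hU with rfl | rfl
    · exact isOpen_of_agree hlt fun f hf g hfg => ofFun_mem_Vset_of_agree hfg hf
    · exact isOpen_of_agree hlt fun f hf g hfg hg =>
        hf (ofFun_mem_Vset_of_agree (fun α hα => (hfg α hα).symm) hg)
  · rcases hU with rfl | rfl
    · exact isOpen_of_agree isSuccLimit_omega1.bot_lt fun _ hf => (hgt.not_ge hf.1).elim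
    · exact isOpen_of_agree isSuccLimit_omega1.bot_lt fun _ _ _ _ hg => hgt.not_ge hg.1

end TreeEx

theorem stmt19 :
    Nonempty (@Homeomorph {p : TreeEx // htx p = (Cardinal.aleph 1).ord}
      (∀ _ : Set.Iio omega1, Bool) _
      (boundedTopology fun _ : Set.Iio omega1 => Bool)) := by
  exact ⟨@Homeomorph.mk _ _ _ (boundedTopology fun _ => Bool) TreeEx.levelEquiv
    TreeEx.continuous_levelEquiv (continuous_induced_rng.2 TreeEx.continuous_ofFun)⟩
end
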